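/- arXiv:1003.5084 — 3 statements merged into one kernel-verified Lean document; each statement's English description precedes it below -/
import Mathlib

section
/- Fix 0 < δ < ε < 1/2, a constant c > 0, and unit vectors k₋, k₊ ∈ ℂ. Let P := [0,ε] ∪ [1−ε,1] and suppose h̄ : P → ℂ is smooth with h̄'(r)/|h̄'(r)| = k₋ and ⟨h̄(r), i·k₋⟩ = c for r ∈ [0,ε], and h̄'(r)/|h̄'(r)| = k₊ and ⟨h̄(r), i·k₊⟩ = c for r ∈ [1−ε,1]. Then for every smooth immersion h : [0,1] → ℂ with h = h̄ on P there exists a smooth map g : [0,1] → ℂ such that (h,g) satisfies the stabilization conditions on [0,1] and g = h̄ on [0,δ] ∪ [1−δ,1]. -/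
/-- The real inner product `⟨z,w⟩ = Re (z · conj w)` on `ℂ ≅ ℝ²`. -/
noncomputable def rinner (z w : ℂ) : ℝ := (z * (starRingEnd ℂ) w).re

/-- The pair `(h,g)` satisfies the stabilization conditions on `S`:
`⟨g'(r), i·h'(r)⟩ = 0` and `⟨g(r), i·h'(r)⟩ > 0` for all `r ∈ S`. -/
def StabOn (h g : ℝ → ℂ) (S : Set ℝ) : Prop :=
  ∀ r ∈ S, rinner (deriv g r) (Complex.I * deriv h r) = 0 ∧
    0 < rinner (g r) (Complex.I * deriv h r)

theorem rinner_eq (z w : ℂ) : rinner z w = z.re * w.re + z.im * w.im := by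
  simp [rinner]

/-- Expansion of a vector in the orthonormal frame `(k, i·k)`. -/
theorem eq_rinner_add_rinner_mul {k : ℂ} (hk : ‖k‖ = 1) (z : ℂ) :
    z = ((rinner z k : ℂ) + (rinner z (Complex.I * k) : ℂ) * Complex.I) * k := by
  have h1 : k.re * k.re + k.im * k.im = 1 := by
    rw [← Complex.normSq_apply, Complex.normSq_eq_norm_sq, hk, one_pow]
  apply Complex.ext
  · simp [rinner_eq]
    linear_combination (-z.re) * h1
  · simp [rinner_eq]
    linear_combination (-z.im) * h1

theorem ContDiff.rinner {n : WithTop ℕ∞} {f g : ℝ → ℂ} (hf : ContDiff ℝ n f)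
    (hg : ContDiff ℝ n g) : ContDiff ℝ n fun r => rinner (f r) (g r) := by
  simp only [rinner_eq]
  have re {f : ℝ → ℂ} (hf : ContDiff ℝ n f) : ContDiff ℝ n fun r => (f r).re :=
    Complex.reCLM.contDiff.comp hf
  have im {f : ℝ → ℂ} (hf : ContDiff ℝ n f) : ContDiff ℝ n fun r => (f r).im :=
    Complex.imCLM.contDiff.comp hf
  exact ((re hf).mul (re hg)).add ((im hf).mul (im hg))

/-- A curve of unit vectors is orthogonal to its derivative. -/
theorem rinner_deriv_self_eq_zero {u : ℝ → ℂ} {u' : ℂ} {r : ℝ} (hu : ∀ s, ‖u s‖ = 1)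
    (hd : HasDerivAt u u' r) : rinner u' (u r) = 0 := by
  have h1 : (fun s => (u s).re * (u s).re + (u s).im * (u s).im) = fun _ => (1 : ℝ) := by
    funext s
    rw [← Complex.normSq_apply, Complex.normSq_eq_norm_sq, hu, one_pow]
  have hre : HasDerivAt (fun s => (u s).re) u'.re r :=
    Complex.reCLM.hasFDerivAt.comp_hasDerivAt r hd
  have him : HasDerivAt (fun s => (u s).im) u'.im r :=
    Complex.imCLM.hasFDerivAt.comp_hasDerivAt r hd
  have h2 := (hre.mul hre).add (him.mul him)
  have h3 : HasDerivAt (fun s => (u s).re * (u s).re + (u s).im * (u s).im) 0 r := by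
    rw [h1]
    exact hasDerivAt_const r 1
  have h4 := h2.unique h3
  rw [rinner_eq]
  linarith

/-- There is a smooth function equal to `1` outside `(δ, 1 - δ)` and to `0` on `[ε, 1 - ε]`. -/
theorem exists_contDiff_cutoff {δ ε : ℝ} (hδε : δ < ε) :
    ∃ χ : ℝ → ℝ, ContDiff ℝ (⊤ : ℕ∞) χ ∧ (∀ r, r ≤ δ → χ r = 1) ∧
      (∀ r, 1 - δ ≤ r → χ r = 1) ∧ ∀ r ∈ Set.Icc ε (1 - ε), χ r = 0 := by
  have hpos : 0 < ε - δ := sub_pos.2 hδε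
  refine ⟨fun r => 1 - Real.smoothTransition ((r - δ) / (ε - δ)) *
    Real.smoothTransition ((1 - δ - r) / (ε - δ)), ?_, ?_, ?_, ?_⟩
  · refine contDiff_const.sub (ContDiff.mul ?_ ?_)
    · exact Real.smoothTransition.contDiff.comp ((contDiff_id.sub contDiff_const).div_const _)
    · exact Real.smoothTransition.contDiff.comp ((contDiff_const.sub contDiff_id).div_const _)
  · intro r hr
    simp [Real.smoothTransition.zero_of_nonpos
      (div_nonpos_of_nonpos_of_nonneg (sub_nonpos.2 hr) hpos.le)]
  · intro r hr
    simp [Real.smoothTransition.zero_of_nonpos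
      (div_nonpos_of_nonpos_of_nonneg (sub_nonpos.2 hr) hpos.le)]
  · intro r hr
    have h1 : 1 ≤ (r - δ) / (ε - δ) := by
      rw [one_le_div hpos]
      linarith [hr.1]
    have h2 : 1 ≤ (1 - δ - r) / (ε - δ) := by
      rw [one_le_div hpos]
      linarith [hr.2]
    simp [Real.smoothTransition.one_of_one_le h1, Real.smoothTransition.one_of_one_le h2]

theorem deriv_eq_of_eqOn_Icc {f g : ℝ → ℂ} {a b : ℝ} (hab : a < b) (hf : Differentiable ℝ f)
    (hg : Differentiable ℝ g) (hfg : Set.EqOn f g (Set.Icc a b)) {r : ℝ}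
    (hr : r ∈ Set.Icc a b) : deriv f r = deriv g r := by
  have hu := uniqueDiffOn_Icc hab r hr
  rw [← (hf r).derivWithin hu, ← (hg r).derivWithin hu]
  exact derivWithin_congr hfg (hfg hr)

/-- If the slope of an immersion of `[0,1]` is constant near both end points, then it extends to a
smooth curve of unit vectors on `ℝ` that is constant outside `[ε, 1 - ε]`. -/
theorem exists_contDiff_slope {ε : ℝ} (hε0 : 0 < ε) (hε : ε < 1 / 2) {km kp : ℂ}
    (hkm : ‖km‖ = 1) (hkp : ‖kp‖ = 1) {v : ℝ → ℂ} (hv : ContDiff ℝ (⊤ : ℕ∞) v)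
    (hv0 : ∀ r ∈ Set.Icc (0 : ℝ) 1, v r ≠ 0)
    (hm : ∀ r ∈ Set.Icc (0 : ℝ) ε, v r / (‖v r‖ : ℂ) = km)
    (hp : ∀ r ∈ Set.Icc (1 - ε) (1 : ℝ), v r / (‖v r‖ : ℂ) = kp) :
    ∃ u : ℝ → ℂ, ContDiff ℝ (⊤ : ℕ∞) u ∧ (∀ r, ‖u r‖ = 1) ∧
      (∀ r ∈ Set.Icc (0 : ℝ) 1, v r = (‖v r‖ : ℂ) * u r) ∧
      (∀ r < ε, u r = km) ∧ ∀ r > 1 - ε, u r = kp := by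
  let u : ℝ → ℂ := fun r => if r < ε then km else if 1 - ε < r then kp else v r / (‖v r‖ : ℂ)
  have hum : ∀ r < ε, u r = km := fun r hr => if_pos hr
  have hup : ∀ r > 1 - ε, u r = kp := fun r hr => by
    have h1 : ¬ r < ε := by linarith
    have h2 : 1 - ε < r := hr
    simp [u, h1, h2]
  have huv : ∀ r ∈ Set.Icc (0 : ℝ) 1, u r = v r / (‖v r‖ : ℂ) := by
    intro r hr
    by_cases h1 : r < ε
    · rw [hum r h1, hm r ⟨hr.1, h1.le⟩]
    · by_cases h2 : 1 - ε < r
      · rw [hup r h2, hp r ⟨h2.le, hr.2⟩]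
      · simp [u, h1, h2]
  refine ⟨u, ?_, ?_, ?_, hum, hup⟩
  · rw [contDiff_iff_contDiffAt]
    intro r
    rcases lt_or_ge r ε with h1 | h1
    · refine contDiffAt_const (c := km) |>.congr_of_eventuallyEq ?_
      filter_upwards [Iio_mem_nhds h1] with s hs using hum s hs
    rcases lt_or_ge (1 - ε) r with h2 | h2
    · refine contDiffAt_const (c := kp) |>.congr_of_eventuallyEq ?_
      filter_upwards [Ioi_mem_nhds h2] with s hs using hup s hs
    have hr0 : 0 < r := by linarith
    have hr1 : r < 1 := by linarith
    have hne := hv0 r ⟨hr0.le, hr1.le⟩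
    have hs : ContDiffAt ℝ (⊤ : ℕ∞) (fun s => (‖v s‖)⁻¹ • v s) r :=
      ((hv.contDiffAt.norm ℝ hne).inv (norm_ne_zero_iff.2 hne)).smul hv.contDiffAt
    refine hs.congr_of_eventuallyEq ?_
    filter_upwards [Icc_mem_nhds hr0 hr1] with s hs
    rw [huv s hs, Complex.real_smul, Complex.ofReal_inv, div_eq_inv_mul]
  · intro r
    rcases lt_or_ge r ε with h1 | h1
    · rw [hum r h1, hkm]
    rcases lt_or_ge (1 - ε) r with h2 | h2
    · rw [hup r h2, hkp]
    have hr : r ∈ Set.Icc (0 : ℝ) 1 := ⟨by linarith, by linarith⟩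
    rw [huv r hr, norm_div, Complex.norm_real, norm_norm,
      div_self (norm_ne_zero_iff.2 (hv0 r hr))]
  · intro r hr
    rw [huv r hr, mul_div_cancel₀]
    exact_mod_cast norm_ne_zero_iff.2 (hv0 r hr)

/-- stabilization for constant slopes near the boundary with
`ḡ = h̄`: every immersion agreeing with `h̄` near the boundary admits a
stabilizing map `g` equal to `h̄` on `[0,δ] ∪ [1−δ,1]`. -/
theorem stmt3 (δ ε : ℝ) (hδ : 0 < δ) (hδε : δ < ε) (hε : ε < 1/2)
    (c : ℝ) (hc : 0 < c)
    (km kp : ℂ) (hkm : ‖km‖ = 1) (hkp : ‖kp‖ = 1)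
    (hbar : ℝ → ℂ) (hbar_sm : ContDiff ℝ (⊤ : ℕ∞) hbar)
    (hyp_m : ∀ r ∈ Set.Icc (0:ℝ) ε, deriv hbar r ≠ 0 ∧
      deriv hbar r / (‖deriv hbar r‖ : ℂ) = km ∧
      rinner (hbar r) (Complex.I * km) = c)
    (hyp_p : ∀ r ∈ Set.Icc (1 - ε) (1:ℝ), deriv hbar r ≠ 0 ∧
      deriv hbar r / (‖deriv hbar r‖ : ℂ) = kp ∧
      rinner (hbar r) (Complex.I * kp) = c) :
    ∀ h : ℝ → ℂ, ContDiff ℝ (⊤ : ℕ∞) h →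
      (∀ r ∈ Set.Icc (0:ℝ) 1, deriv h r ≠ 0) →
      Set.EqOn h hbar (Set.Icc 0 ε ∪ Set.Icc (1 - ε) 1) →
      ∃ g : ℝ → ℂ, ContDiff ℝ (⊤ : ℕ∞) g ∧
        StabOn h g (Set.Icc 0 1) ∧
        Set.EqOn g hbar (Set.Icc 0 δ ∪ Set.Icc (1 - δ) 1) := by
  intro h h_sm h_imm h_eq
  have hε0 : 0 < ε := hδ.trans hδε
  have hh : Differentiable ℝ h := h_sm.differentiable (by simp)
  have hb : Differentiable ℝ hbar := hbar_sm.differentiable (by simp)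
  have hdm : ∀ r ∈ Set.Icc (0 : ℝ) ε, deriv h r = deriv hbar r := fun r hr =>
    deriv_eq_of_eqOn_Icc hε0 hh hb (h_eq.mono Set.subset_union_left) hr
  have hdp : ∀ r ∈ Set.Icc (1 - ε) (1 : ℝ), deriv h r = deriv hbar r := fun r hr =>
    deriv_eq_of_eqOn_Icc (by linarith) hh hb (h_eq.mono Set.subset_union_right) hr
  obtain ⟨u, u_sm, hu1, hu, hum, hup⟩ := exists_contDiff_slope hε0 hε hkm hkp
    (contDiff_infty_iff_deriv.1 h_sm).2 h_imm
    (fun r hr => by rw [hdm r hr]; exact (hyp_m r hr).2.1)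
    (fun r hr => by rw [hdp r hr]; exact (hyp_p r hr).2.1)
  obtain ⟨χ, χ_sm, hχm, hχp, hχ0⟩ := exists_contDiff_cutoff hδε
  have f_sm : ContDiff ℝ (⊤ : ℕ∞) fun r => χ r * rinner (hbar r) (u r) :=
    χ_sm.mul (hbar_sm.rinner u_sm)
  refine ⟨fun r => ((χ r * rinner (hbar r) (u r) : ℝ) + (c : ℂ) * Complex.I) * u r, ?_, ?_, ?_⟩
  · exact ((Complex.ofRealCLM.contDiff.comp f_sm).add contDiff_const).mul u_sm
  · intro r hr
    have hn : 0 < ‖deriv h r‖ := norm_pos_iff.2 (h_imm r hr)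
    have hsq : (u r).re * (u r).re + (u r).im * (u r).im = 1 := by
      rw [← Complex.normSq_apply, Complex.normSq_eq_norm_sq, hu1, one_pow]
    have hud : HasDerivAt u (deriv u r) r := (u_sm.differentiable (by simp) r).hasDerivAt
    have hperp := rinner_deriv_self_eq_zero hu1 hud
    have hfd := (f_sm.differentiable (by simp) r).hasDerivAt
    have hfu : χ r * rinner (hbar r) (u r) = 0 ∨ deriv u r = 0 := by
      rcases lt_or_ge r ε with h1 | h1
      · right
        have : u =ᶠ[nhds r] fun _ => km := by
          filter_upwards [Iio_mem_nhds h1] with s hs using hum s hs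
        rw [this.deriv_eq, deriv_const]
      rcases lt_or_ge (1 - ε) r with h2 | h2
      · right
        have : u =ᶠ[nhds r] fun _ => kp := by
          filter_upwards [Ioi_mem_nhds h2] with s hs using hup s hs
        rw [this.deriv_eq, deriv_const]
      · left
        rw [hχ0 r ⟨h1, h2⟩, zero_mul]
    have hgd := ((hfd.ofReal_comp.add_const ((c : ℂ) * Complex.I)).mul hud).deriv
    rw [rinner_eq] at hperp
    rw [hu r hr]
    constructor
    · erw [hgd]
      rcases hfu with h0 | h0
      · rw [h0, rinner_eq]
        simp
        linear_combination ‖deriv h r‖ * c * hperp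
      · rw [h0, rinner_eq]
        simp
        ring
    · have key : rinner (((χ r * rinner (hbar r) (u r) : ℝ) + (c : ℂ) * Complex.I) * u r)
          (Complex.I * ((‖deriv h r‖ : ℂ) * u r)) = c * ‖deriv h r‖ := by
        generalize χ r * rinner (hbar r) (u r) = a
        rw [rinner_eq]
        simp
        linear_combination ‖deriv h r‖ * c * hsq
      rw [key]
      exact mul_pos hc hn
  · rintro r (hr | hr)
    · have hr' : r ∈ Set.Icc (0 : ℝ) ε := ⟨hr.1, hr.2.trans hδε.le⟩
      have := eq_rinner_add_rinner_mul hkm (hbar r)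
      rw [(hyp_m r hr').2.2] at this
      simp only [hum r (hr.2.trans_lt hδε), hχm r hr.2, one_mul]
      exact this.symm
    · have hr' : r ∈ Set.Icc (1 - ε) (1 : ℝ) := ⟨by linarith [hr.1], hr.2⟩
      have := eq_rinner_add_rinner_mul hkp (hbar r)
      rw [(hyp_p r hr').2.2] at this
      simp only [hup r (by linarith [hr.1]), hχp r hr.1, one_mul]
      exact this.symm
end

section
/- Let h : [0,1] → ℂ be a smooth immersion with constant slope, i.e. h'(r)/|h'(r)| = k for a fixed unit vector k ∈ ℂ and all r. Let 0 < ε < 1/2 and let g₀ : [0,ε] → ℂ and g₁ : [1−ε,1] → ℂ be smooth maps such that (h,g₀) and (h,g₁) satisfy the stabilization conditions on [0,ε] and [1−ε,1] respectively; then ⟨g₀(r), i·k⟩ equals a constant c₀ > 0 and ⟨g₁(r), i·k⟩ equals a constant c₁ > 0. There exists a smooth map g : [0,1] → ℂ such that (h,g) satisfies the stabilization conditions on [0,1], g agrees with g₀ on a neighbourhood of 0, and g agrees with g₁ on a neighbourhood of 1, if and only if c₀ = c₁. -/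
/-- The real inner product with a fixed second argument, as a continuous `ℝ`-linear map. -/
noncomputable def rinnerCLM (w : ℂ) : ℂ →L[ℝ] ℝ :=
  Complex.reCLM.comp ((ContinuousLinearMap.mul ℝ ℂ).flip ((starRingEnd ℂ) w))

theorem rinnerCLM_apply (z w : ℂ) : rinnerCLM w z = rinner z w := by
  simp [rinnerCLM, rinner, mul_comm]

theorem contDiff_rinner {n : WithTop ℕ∞} {g : ℝ → ℂ} (hg : ContDiff ℝ n g) (w : ℂ) :
    ContDiff ℝ n fun r => rinner (g r) w := by
  simpa only [Function.comp_def, rinnerCLM_apply] using (rinnerCLM w).contDiff.comp hg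

theorem hasDerivAt_rinner {g : ℝ → ℂ} {r : ℝ} (hg : DifferentiableAt ℝ g r) (w : ℂ) :
    HasDerivAt (fun s => rinner (g s) w) (rinner (deriv g r) w) r := by
  simpa only [Function.comp_def, rinnerCLM_apply] using
    (rinnerCLM w).hasFDerivAt.comp_hasDerivAt r hg.hasDerivAt

theorem rinner_I_mul_ofReal_mul (z k : ℂ) (t : ℝ) :
    rinner z (Complex.I * (t * k)) = t * rinner z (Complex.I * k) := by
  simp [rinner]
  ring

theorem rinner_add_smul_frame {k : ℂ} (hk : ‖k‖ = 1) (a b : ℝ) :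
    rinner (a * (Complex.I * k) + b * k) (Complex.I * k) = a := by
  have h1 : k.re * k.re + k.im * k.im = 1 := by
    rw [← Complex.normSq_apply, Complex.normSq_eq_norm_sq, hk, one_pow]
  simp [rinner]
  linear_combination a * h1

theorem eq_rinner_frame {k : ℂ} (hk : ‖k‖ = 1) (z : ℂ) :
    (rinner z (Complex.I * k) : ℂ) * (Complex.I * k) + (rinner z k : ℂ) * k = z := by
  have h1 : k.re * k.re + k.im * k.im = 1 := by
    rw [← Complex.normSq_apply, Complex.normSq_eq_norm_sq, hk, one_pow]
  apply Complex.ext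
  · simp [rinner]
    linear_combination z.re * h1
  · simp [rinner]
    linear_combination z.im * h1

/-- Where `h` has slope `k`, the stabilization conditions only involve `k`. -/
theorem stabOn_iff_of_slope {h g : ℝ → ℂ} {k : ℂ} {S : Set ℝ}
    (hslope : ∀ r ∈ S, deriv h r ≠ 0 ∧ deriv h r / (‖deriv h r‖ : ℂ) = k) :
    StabOn h g S ↔ ∀ r ∈ S, rinner (deriv g r) (Complex.I * k) = 0 ∧
      0 < rinner (g r) (Complex.I * k) := by
  refine forall₂_congr fun r hr => ?_
  obtain ⟨hne, hdiv⟩ := hslope r hr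
  have hpos : 0 < ‖deriv h r‖ := norm_pos_iff.mpr hne
  have hcast : (‖deriv h r‖ : ℂ) ≠ 0 := by exact_mod_cast hpos.ne'
  have hd : deriv h r = (‖deriv h r‖ : ℂ) * k := by
    rw [← hdiv, mul_div_cancel₀ _ hcast]
  have key (z : ℂ) : rinner z (Complex.I * deriv h r) =
      ‖deriv h r‖ * rinner z (Complex.I * k) := by
    rw [← rinner_I_mul_ofReal_mul, ← hd]
  rw [key, key, mul_eq_zero, or_iff_right hpos.ne', mul_pos_iff_of_pos_left hpos]

theorem rinner_eq_left_of_deriv {g : ℝ → ℂ} (hg : Differentiable ℝ g) {w : ℂ} {a b : ℝ}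
    (hd : ∀ r ∈ Set.Icc a b, rinner (deriv g r) w = 0) :
    ∀ r ∈ Set.Icc a b, rinner (g r) w = rinner (g a) w := by
  have hder (r : ℝ) := hasDerivAt_rinner (hg r) w
  refine constant_of_has_deriv_right_zero
    (fun r _ => (hder r).continuousAt.continuousWithinAt) fun r hr => ?_
  rw [← hd r (Set.Ico_subset_Icc_self hr)]
  exact (hder r).hasDerivWithinAt

/-- For an immersion of constant slope `k`, the boundary data
`g₀, g₁` have constant positive pairings `c₀ = ⟨g₀, ik⟩`, `c₁ = ⟨g₁, ik⟩`,
and a stabilizing interpolation between `g₀` and `g₁` exists iff `c₀ = c₁`. -/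
theorem stmt4 (k : ℂ) (hk : ‖k‖ = 1) (ε : ℝ) (hε0 : 0 < ε) (hε : ε < 1/2)
    (h g₀ g₁ : ℝ → ℂ)
    (h_sm : ContDiff ℝ (⊤ : ℕ∞) h)
    (g₀_sm : ContDiff ℝ (⊤ : ℕ∞) g₀) (g₁_sm : ContDiff ℝ (⊤ : ℕ∞) g₁)
    (hslope : ∀ r ∈ Set.Icc (0:ℝ) 1, deriv h r ≠ 0 ∧
      deriv h r / (‖deriv h r‖ : ℂ) = k)
    (hstab0 : StabOn h g₀ (Set.Icc 0 ε))
    (hstab1 : StabOn h g₁ (Set.Icc (1 - ε) 1)) :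
    (∃ c₀ : ℝ, 0 < c₀ ∧ ∀ r ∈ Set.Icc (0:ℝ) ε, rinner (g₀ r) (Complex.I * k) = c₀) ∧
    (∃ c₁ : ℝ, 0 < c₁ ∧ ∀ r ∈ Set.Icc (1 - ε) (1:ℝ), rinner (g₁ r) (Complex.I * k) = c₁) ∧
    (∀ c₀ c₁ : ℝ,
      (∀ r ∈ Set.Icc (0:ℝ) ε, rinner (g₀ r) (Complex.I * k) = c₀) →
      (∀ r ∈ Set.Icc (1 - ε) (1:ℝ), rinner (g₁ r) (Complex.I * k) = c₁) →
      ((∃ g : ℝ → ℂ, ContDiff ℝ (⊤ : ℕ∞) g ∧ StabOn h g (Set.Icc 0 1) ∧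
          (∃ t : ℝ, 0 < t ∧ Set.EqOn g g₀ (Set.Icc 0 t)) ∧
          (∃ t : ℝ, 0 < t ∧ Set.EqOn g g₁ (Set.Icc (1 - t) 1))) ↔ c₀ = c₁)) := by
  have hI0 : Set.Icc (0:ℝ) ε ⊆ Set.Icc 0 1 := Set.Icc_subset_Icc le_rfl (by linarith)
  have hI1 : Set.Icc (1 - ε) (1:ℝ) ⊆ Set.Icc 0 1 := Set.Icc_subset_Icc (by linarith) le_rfl
  rw [stabOn_iff_of_slope fun r hr => hslope r (hI0 hr)] at hstab0
  rw [stabOn_iff_of_slope fun r hr => hslope r (hI1 hr)] at hstab1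
  have hm0 : (0:ℝ) ∈ Set.Icc 0 ε := ⟨le_rfl, hε0.le⟩
  have hm1 : 1 - ε ∈ Set.Icc (1 - ε) (1:ℝ) := ⟨le_rfl, by linarith⟩
  have hm1' : (1:ℝ) ∈ Set.Icc (1 - ε) (1:ℝ) := ⟨by linarith, le_rfl⟩
  refine ⟨⟨_, (hstab0 0 hm0).2, rinner_eq_left_of_deriv (g₀_sm.differentiable (by simp))
      fun r hr => (hstab0 r hr).1⟩,
    ⟨_, (hstab1 _ hm1).2, rinner_eq_left_of_deriv (g₁_sm.differentiable (by simp))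
      fun r hr => (hstab1 r hr).1⟩, fun c₀ c₁ hc₀ hc₁ => ⟨?_, ?_⟩⟩
  · rintro ⟨g, g_sm, hstab, ⟨t, ht, hgt⟩, ⟨s, hs, hgs⟩⟩
    rw [stabOn_iff_of_slope hslope] at hstab
    have hconst := rinner_eq_left_of_deriv (g_sm.differentiable (by simp))
      (fun r hr => (hstab r hr).1) 1 ⟨zero_le_one, le_rfl⟩
    rw [hgs ⟨by linarith, le_rfl⟩, hgt ⟨le_rfl, ht.le⟩, hc₀ 0 hm0, hc₁ 1 hm1'] at hconst
    exact hconst.symm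
  · rintro rfl
    let χ : ℝ → ℝ := fun r => Real.smoothTransition ((r - ε) / (1 - 2 * ε))
    have χ_sm : ContDiff ℝ (⊤ : ℕ∞) χ :=
      Real.smoothTransition.contDiff.comp ((contDiff_id.sub contDiff_const).div_const _)
    let b : ℝ → ℝ := fun r => (1 - χ r) * rinner (g₀ r) k + χ r * rinner (g₁ r) k
    have b_sm : ContDiff ℝ (⊤ : ℕ∞) b :=
      ((contDiff_const.sub χ_sm).mul (contDiff_rinner g₀_sm k)).add
        (χ_sm.mul (contDiff_rinner g₁_sm k))
    let g : ℝ → ℂ := fun r => (c₀ : ℂ) * (Complex.I * k) + (b r : ℂ) * k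
    have g_sm : ContDiff ℝ (⊤ : ℕ∞) g :=
      contDiff_const.add ((Complex.ofRealCLM.contDiff.comp b_sm).mul contDiff_const)
    have hg (r : ℝ) : rinner (g r) (Complex.I * k) = c₀ := rinner_add_smul_frame hk c₀ (b r)
    have hpos : 0 < 1 - 2 * ε := by linarith
    refine ⟨g, g_sm, (stabOn_iff_of_slope hslope).mpr fun r _ => ⟨?_, ?_⟩,
      ⟨ε, hε0, fun r hr => ?_⟩, ⟨ε, hε0, fun r hr => ?_⟩⟩
    · have hd := hasDerivAt_rinner (g_sm.differentiable (by simp) r) (Complex.I * k)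
      simp only [hg] at hd
      exact hd.unique (hasDerivAt_const r c₀)
    · rw [hg, ← hc₀ 0 hm0]
      exact (hstab0 0 hm0).2
    · have hχ : χ r = 0 := Real.smoothTransition.zero_of_nonpos
        (div_nonpos_of_nonpos_of_nonneg (by linarith [hr.2]) hpos.le)
      have hb : b r = rinner (g₀ r) k := by simp [b, hχ]
      simp only [g, hb, ← hc₀ r hr]
      exact eq_rinner_frame hk (g₀ r)
    · have hχ : χ r = 1 := Real.smoothTransition.one_of_one_le
        ((one_le_div hpos).mpr (by linarith [hr.1]))
      have hb : b r = rinner (g₁ r) k := by simp [b, hχ]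
      simp only [g, hb, ← hc₁ r hr]
      exact eq_rinner_frame hk (g₁ r)
end

section
/- Let 0 < ε < 1/2 and let h̄, ḡ : [0,1] → ℂ be smooth maps such that (h̄,ḡ) satisfies the stabilization conditions on [0,1] and the slope h̄'/|h̄'| is not constant on [ε,1−ε]. Set P := [0,ε] ∪ [1−ε,1]. Then there exist constants C > 0 and δ > 0 such that for every smooth map ξ : [0,1] → ℂ vanishing on P with ‖ξ‖_{C¹} < δ there exists a smooth family g_t : [0,1] → ℂ, t ∈ [0,1], with the following properties: for every t, the pair (h̄ + t·ξ, g_t) satisfies the stabilization conditions on [0,1] and g_t = ḡ on P; and ‖∂_t g_t‖_{C¹} ≤ C·‖ξ‖_{C¹} for all t ∈ [0,1]. -/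
/-- The `C¹`-norm of a map on `[0,1]`: `sup |f| + sup |f'|`. -/
noncomputable def C1Norm (f : ℝ → ℂ) : ℝ :=
  (⨆ r : Set.Icc (0:ℝ) 1, ‖f r.1‖) + (⨆ r : Set.Icc (0:ℝ) 1, ‖deriv f r.1‖)

open scoped ContDiff

theorem hasDerivAt_primitive {f : ℝ → ℂ} (hf : Continuous f) (r : ℝ) :
    HasDerivAt (fun r => ∫ s in (0:ℝ)..r, f s) (f r) r :=
  intervalIntegral.integral_hasDerivAt_right (hf.intervalIntegrable _ _)
    (hf.stronglyMeasurableAtFilter _ _) hf.continuousAt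

theorem contDiff_primitive {f : ℝ → ℂ} (hf : ContDiff ℝ ∞ f) :
    ContDiff ℝ ∞ (fun r => ∫ s in (0:ℝ)..r, f s) := by
  rw [contDiff_infty_iff_deriv]
  refine ⟨fun r => (hasDerivAt_primitive hf.continuous r).differentiableAt, ?_⟩
  have : deriv (fun r => ∫ s in (0:ℝ)..r, f s) = f :=
    funext fun r => (hasDerivAt_primitive hf.continuous r).deriv
  rwa [this]

theorem norm_primitive_le {f : ℝ → ℂ} {K : ℝ} (hK : 0 ≤ K)
    (hf : ∀ r ∈ Set.Icc (0:ℝ) 1, ‖f r‖ ≤ K) {r : ℝ} (hr : r ∈ Set.Icc (0:ℝ) 1) :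
    ‖∫ s in (0:ℝ)..r, f s‖ ≤ K := by
  have h := intervalIntegral.norm_integral_le_of_norm_le_const (a := 0) (b := r) (f := f) (C := K)
    (fun x hx => by
      rw [Set.uIoc_of_le hr.1] at hx
      exact hf x ⟨hx.1.le, hx.2.trans hr.2⟩)
  rw [sub_zero, abs_of_nonneg hr.1] at h
  nlinarith [hr.2]

/-- A smooth bounded reparametrization of the line that is the identity near `[0,1]`. -/
theorem exists_smooth_truncation : ∃ χ : ℝ → ℝ, ContDiff ℝ ∞ χ ∧ (∀ t, |χ t| ≤ 3) ∧
    ∀ t ∈ Set.Icc (0:ℝ) 1, χ t = t ∧ HasDerivAt χ 1 t := by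
  have key : ∀ t ∈ Set.Icc (-1:ℝ) 2,
      t * (Real.smoothTransition (t + 2) * Real.smoothTransition (3 - t)) = t := by
    intro t ht
    rw [Real.smoothTransition.one_of_one_le (by linarith [ht.1]),
      Real.smoothTransition.one_of_one_le (by linarith [ht.2])]
    ring
  refine ⟨fun t => t * (Real.smoothTransition (t + 2) * Real.smoothTransition (3 - t)),
    ?_, ?_, ?_⟩
  · have h := Real.smoothTransition.contDiff (n := ⊤)
    fun_prop
  · intro t
    rcases lt_or_ge t (-2) with h | h
    · simp [Real.smoothTransition.zero_of_nonpos (show t + 2 ≤ 0 by linarith)]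
    rcases lt_or_ge 3 t with h' | h'
    · simp [Real.smoothTransition.zero_of_nonpos (show 3 - t ≤ 0 by linarith)]
    have h1 := Real.smoothTransition.nonneg (t + 2)
    have h2 := Real.smoothTransition.nonneg (3 - t)
    rw [abs_mul, abs_of_nonneg (mul_nonneg h1 h2)]
    have h3 : |t| ≤ 3 := abs_le.2 ⟨by linarith, h'⟩
    have h4 : Real.smoothTransition (t + 2) * Real.smoothTransition (3 - t) ≤ 1 :=
      mul_le_one₀ (Real.smoothTransition.le_one _) h2 (Real.smoothTransition.le_one _)
    nlinarith [abs_nonneg t, mul_nonneg h1 h2]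
  · intro t ht
    refine ⟨key t ⟨by linarith [ht.1], by linarith [ht.2]⟩, ?_⟩
    refine (hasDerivAt_id t).congr_of_eventuallyEq ?_
    filter_upwards [Icc_mem_nhds (show (-1:ℝ) < t by linarith [ht.1])
      (show t < 2 by linarith [ht.2])] with s hs
    exact key s hs

/-- Smooth solution `c` of `c + t • (b + B c) = 0` for a small operator `B`, with bounds. -/
theorem exists_smooth_solution {E : Type*} [NormedAddCommGroup E] [NormedSpace ℝ E]
    [CompleteSpace E] (B : E →L[ℝ] E) (b : E) (hB : ‖B‖ ≤ 1 / 6) :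
    ∃ c : ℝ → E, ContDiff ℝ ∞ c ∧ ∀ t ∈ Set.Icc (0:ℝ) 1,
      c t + t • (b + B (c t)) = 0 ∧ ‖c t‖ ≤ 2 * ‖b‖ ∧ ‖deriv c t‖ ≤ 4 * ‖b‖ := by
  obtain ⟨χ, hχ, hχ3, hχ1⟩ := exists_smooth_truncation
  have hunit : ∀ t, IsUnit (1 + χ t • B : E →L[ℝ] E) := by
    intro t
    have h : ‖-(χ t • B)‖ < 1 := by
      rw [norm_neg, norm_smul, Real.norm_eq_abs]
      nlinarith [hχ3 t, abs_nonneg (χ t), norm_nonneg B]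
    have := isUnit_one_sub_of_norm_lt_one h
    rwa [sub_neg_eq_add] at this
  set c : ℝ → E := fun t => Ring.inverse (1 + χ t • B : E →L[ℝ] E) (-(χ t • b)) with hc
  have hcs : ContDiff ℝ ∞ c := by
    have h1 : ContDiff ℝ ∞ (fun t => Ring.inverse (1 + χ t • B : E →L[ℝ] E)) := by
      rw [contDiff_iff_contDiffAt]
      intro t
      obtain ⟨u, hu⟩ := hunit t
      have h2 : ContDiffAt ℝ ∞ (fun t => (1 + χ t • B : E →L[ℝ] E)) t := by fun_prop
      have h3 := contDiffAt_ringInverse ℝ (n := ∞) u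
      rw [hu] at h3
      exact h3.comp t h2
    exact h1.clm_apply (by fun_prop)
  have heq : ∀ t, c t + χ t • (b + B (c t)) = 0 := by
    intro t
    have h := congrArg (fun L : E →L[ℝ] E => L (-(χ t • b))) (Ring.mul_inverse_cancel _ (hunit t))
    change c t + χ t • B (c t) = _ at h
    rw [smul_add, add_left_comm, h]
    exact add_neg_cancel _
  refine ⟨c, hcs, fun t ht => ?_⟩
  obtain ⟨h1, h2⟩ := hχ1 t ht
  have hd : HasDerivAt c (deriv c t) t :=
    (hcs.differentiable (by simp) t).hasDerivAt
  have e1 := heq t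
  have e2 : deriv c t + (t • B (deriv c t) + (b + B (c t))) = 0 := by
    have h3 : HasDerivAt (fun t => c t + χ t • (b + B (c t)))
        (deriv c t + (χ t • B (deriv c t) + (1:ℝ) • (b + B (c t)))) t :=
      hd.add (h2.smul ((B.hasFDerivAt.comp_hasDerivAt t hd).const_add b))
    have h4 : (fun t => c t + χ t • (b + B (c t))) = fun _ => 0 := funext heq
    rw [h4] at h3
    have := h3.unique (hasDerivAt_const t 0)
    rwa [h1, one_smul] at this
  rw [h1] at e1
  have hBn : ∀ v, ‖B v‖ ≤ 1 / 6 * ‖v‖ := fun v => B.le_of_opNorm_le hB v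
  have ht' : ‖t‖ ≤ 1 := by rw [Real.norm_eq_abs, abs_of_nonneg ht.1]; exact ht.2
  have hts : ∀ v : E, ‖t • v‖ ≤ ‖v‖ := fun v => by
    rw [norm_smul]; nlinarith [norm_nonneg v]
  have b1 : ‖c t‖ ≤ 2 * ‖b‖ := by
    have h5 : c t = -(t • (b + B (c t))) := eq_neg_of_add_eq_zero_left e1
    have h6 : ‖c t‖ ≤ ‖b‖ + 1 / 6 * ‖c t‖ := calc
      ‖c t‖ = ‖t • (b + B (c t))‖ := by conv_lhs => rw [h5, norm_neg]
      _ ≤ ‖b + B (c t)‖ := hts _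
      _ ≤ ‖b‖ + ‖B (c t)‖ := norm_add_le _ _
      _ ≤ _ := by linarith [hBn (c t)]
    linarith [norm_nonneg b]
  refine ⟨e1, b1, ?_⟩
  have h5 : deriv c t = -(t • B (deriv c t) + (b + B (c t))) := eq_neg_of_add_eq_zero_left e2
  have h6 : ‖deriv c t‖ ≤ 1 / 6 * ‖deriv c t‖ + (‖b‖ + 1 / 6 * ‖c t‖) := calc
    ‖deriv c t‖ = ‖t • B (deriv c t) + (b + B (c t))‖ := by conv_lhs => rw [h5, norm_neg]
    _ ≤ ‖t • B (deriv c t)‖ + (‖b‖ + ‖B (c t)‖) :=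
      (norm_add_le _ _).trans (by gcongr; exact norm_add_le _ _)
    _ ≤ _ := by linarith [hBn (c t), hBn (deriv c t), hts (B (deriv c t))]
  linarith [norm_nonneg b]

theorem norm_deriv_le_C1Norm {f : ℝ → ℂ} (hf : ContDiff ℝ ∞ f) {r : ℝ} (hr : r ∈ Set.Icc (0:ℝ) 1) :
    ‖deriv f r‖ ≤ C1Norm f := by
  have h1 : 0 ≤ ⨆ r : Set.Icc (0:ℝ) 1, ‖f r.1‖ := Real.iSup_nonneg fun _ => norm_nonneg _
  have hc : Continuous (deriv f) := hf.continuous_deriv (by simp)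
  have h2 : BddAbove (Set.range fun r : Set.Icc (0:ℝ) 1 => ‖deriv f r.1‖) :=
    (isCompact_range (by fun_prop)).bddAbove
  have h3 := le_ciSup h2 ⟨r, hr⟩
  simp only at h3
  unfold C1Norm
  linarith

theorem C1Norm_le {f : ℝ → ℂ} {K : ℝ}
    (h0 : ∀ r ∈ Set.Icc (0:ℝ) 1, ‖f r‖ ≤ K) (h1 : ∀ r ∈ Set.Icc (0:ℝ) 1, ‖deriv f r‖ ≤ K) :
    C1Norm f ≤ 2 * K := by
  have : Nonempty (Set.Icc (0:ℝ) 1) := ⟨⟨0, by simp⟩⟩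
  have a := ciSup_le fun r : Set.Icc (0:ℝ) 1 => h0 r.1 r.2
  have b := ciSup_le fun r : Set.Icc (0:ℝ) 1 => h1 r.1 r.2
  unfold C1Norm
  linarith

theorem slope_eq_of_forall_inner_eq_zero {u : ℝ → ℂ} (hu : Continuous u) {a b : ℝ}
    (hab : a < b) (hu0 : ∀ r ∈ Set.Icc a b, u r ≠ 0) {c : ℂ} (hc : c ≠ 0)
    (h : ∀ r ∈ Set.Ioo a b, inner ℝ c (u r) = 0) {r₁ r₂ : ℝ} (h₁ : r₁ ∈ Set.Icc a b)
    (h₂ : r₂ ∈ Set.Icc a b) : u r₁ / (‖u r₁‖ : ℂ) = u r₂ / (‖u r₂‖ : ℂ) := by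
  have hcl : ∀ r ∈ Set.Icc a b, inner ℝ c (u r) = 0 := by
    have hclosed : IsClosed {r | inner ℝ c (u r) = 0} :=
      isClosed_eq (by fun_prop) continuous_const
    have := closure_minimal h hclosed
    rwa [closure_Ioo hab.ne] at this
  set s : ℝ → ℝ := fun r => inner ℝ (Complex.I * c) (u r) with hs
  have hsc : Continuous s := by fun_prop
  have hcn : ((‖c‖ ^ 2 : ℝ) : ℂ) ≠ 0 := by
    exact_mod_cast (pow_ne_zero 2 (norm_ne_zero_iff.2 hc))
  have hus : ∀ r ∈ Set.Icc a b, ((‖c‖ ^ 2 : ℝ) : ℂ) * u r = (s r : ℂ) * (Complex.I * c) := by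
    intro r hr
    have h0 := hcl r hr
    rw [← Complex.normSq_eq_norm_sq]
    simp only [hs, Complex.inner, Complex.mul_re, Complex.mul_im, map_mul, Complex.conj_re,
      Complex.conj_im, Complex.I_re, Complex.I_im, Complex.conj_I, Complex.neg_re,
      Complex.neg_im] at h0 ⊢
    apply Complex.ext <;> simp [Complex.normSq_apply]
    · linear_combination c.re * h0
    · linear_combination c.im * h0
  have hs0 : ∀ r ∈ Set.Icc a b, s r ≠ 0 := by
    intro r hr h0
    have := hus r hr
    rw [h0, Complex.ofReal_zero, zero_mul] at this
    exact (mul_ne_zero hcn (hu0 r hr)) this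
  have hsign : 0 < s r₁ * s r₂ := by
    by_contra! hneg
    have h0 : (0:ℝ) ∈ Set.uIcc (s r₁) (s r₂) := by
      rw [Set.mem_uIcc]
      rcases le_total (s r₁) 0 with h | h <;> rcases le_total (s r₂) 0 with h' | h'
      · have h3 := mul_pos_of_neg_of_neg (h.lt_of_ne (hs0 _ h₁)) (h'.lt_of_ne (hs0 _ h₂))
        linarith
      · exact Or.inl ⟨h, h'⟩
      · exact Or.inr ⟨h', h⟩
      · have h3 := mul_pos (h.lt_of_ne (hs0 _ h₁).symm) (h'.lt_of_ne (hs0 _ h₂).symm)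
        linarith
    obtain ⟨r, hr, hr0⟩ := intermediate_value_uIcc hsc.continuousOn h0
    exact hs0 r ((Set.ordConnected_Icc.uIcc_subset h₁ h₂) hr) hr0
  have hpar : u r₁ = ((s r₁ / s r₂ : ℝ) : ℂ) * u r₂ := by
    have e2 : (s r₂ : ℂ) ≠ 0 := by exact_mod_cast hs0 _ h₂
    have e3 := hus _ h₁
    have e4 := hus _ h₂
    apply mul_left_cancel₀ hcn
    push_cast at *
    field_simp
    linear_combination (s r₂ : ℂ) * e3 - (s r₁ : ℂ) * e4
  have hq : 0 < s r₁ / s r₂ := by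
    rw [div_eq_mul_inv]
    have := hs0 _ h₂
    have h3 : s r₁ * (s r₂)⁻¹ = (s r₁ * s r₂) * ((s r₂)⁻¹) ^ 2 := by field_simp
    rw [h3]
    positivity
  rw [hpar, norm_mul, Complex.norm_real, Real.norm_of_nonneg hq.le, Complex.ofReal_mul,
    mul_div_mul_left _ _ (by exact_mod_cast hq.ne')]

/-- If the slope of an immersion with derivative `u` is not constant on `[ε, 1 - ε]`, weights
vanishing off `(ε, 1 - ε)` realize every value of the moment `∫ φ u`. -/
theorem exists_weight {ε : ℝ} (hε0 : 0 < ε) (hε : ε < 1 / 2) {u : ℝ → ℂ} (hu : ContDiff ℝ ∞ u)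
    (hu0 : ∀ r ∈ Set.Icc (0:ℝ) 1, u r ≠ 0)
    (hnc : ∃ r₁ ∈ Set.Icc ε (1 - ε), ∃ r₂ ∈ Set.Icc ε (1 - ε),
      u r₁ / (‖u r₁‖ : ℂ) ≠ u r₂ / (‖u r₂‖ : ℂ)) (v : ℂ) :
    ∃ φ : ℝ → ℝ, ContDiff ℝ ∞ φ ∧ (∀ r, r ≤ ε ∨ 1 - ε ≤ r → φ r = 0) ∧
      ∫ r in (0:ℝ)..1, φ r • u r = v := by
  set w : ℝ → ℝ := fun r => expNegInvGlue (r - ε) * expNegInvGlue (1 - ε - r) with hw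
  have hws : ContDiff ℝ ∞ w := by
    have := expNegInvGlue.contDiff (n := ⊤)
    fun_prop
  have hw0 : ∀ r, r ≤ ε ∨ 1 - ε ≤ r → w r = 0 := by
    rintro r (h | h)
    · simp [hw, expNegInvGlue.zero_of_nonpos (sub_nonpos.2 h)]
    · simp [hw, expNegInvGlue.zero_of_nonpos (sub_nonpos.2 h)]
  have hwnn : ∀ r, 0 ≤ w r := fun r => mul_nonneg (expNegInvGlue.nonneg _) (expNegInvGlue.nonneg _)
  have huc := hu.continuous
  have hwc := hws.continuous
  have hint : ∀ c : ℂ, IntervalIntegrable (fun r => (w r * inner ℝ c (u r)) • u r)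
      MeasureTheory.volume 0 1 := fun c => Continuous.intervalIntegrable (by fun_prop) _ _
  let A : ℂ →ₗ[ℝ] ℂ :=
    { toFun := fun c => ∫ r in (0:ℝ)..1, (w r * inner ℝ c (u r)) • u r
      map_add' := fun c d => by
        rw [← intervalIntegral.integral_add (hint c) (hint d)]
        simp only [inner_add_left, mul_add, add_smul]
      map_smul' := fun k c => by
        rw [RingHom.id_apply, ← intervalIntegral.integral_smul]
        simp only [real_inner_smul_left, smul_smul, mul_left_comm] }
  have hA : Function.Injective A := by
    rw [injective_iff_map_eq_zero]
    intro c hc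
    by_contra hc0
    obtain ⟨r₁, h₁, r₂, h₂, hne⟩ := hnc
    refine hne (slope_eq_of_forall_inner_eq_zero huc (by linarith)
      (fun r hr => hu0 r ⟨by linarith [hr.1], by linarith [hr.2]⟩) hc0 ?_ h₁ h₂)
    intro r hr
    by_contra hr0
    have h1 := (innerSL ℝ c).intervalIntegral_comp_comm (hint c)
    have h2 : ∫ r in (0:ℝ)..1, (w r * inner ℝ c (u r)) • u r = 0 := hc
    rw [h2, map_zero] at h1
    simp only [innerSL_apply_apply, inner_smul_right] at h1
    have hpos : 0 < ∫ r in (0:ℝ)..1, w r * inner ℝ c (u r) * inner ℝ c (u r) := by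
      have h3 := intervalIntegral.integral_lt_integral_of_continuousOn_of_le_of_exists_lt
        (a := 0) (b := 1) (f := fun _ => (0:ℝ))
        (g := fun r => w r * inner ℝ c (u r) * inner ℝ c (u r)) one_pos
        continuousOn_const (by fun_prop)
        (fun r _ => by rw [mul_assoc]; exact mul_nonneg (hwnn r) (mul_self_nonneg _))
        ⟨r, ⟨by linarith [hr.1], by linarith [hr.2]⟩, by
          rw [mul_assoc]
          exact mul_pos (mul_pos (expNegInvGlue.pos_of_pos (by linarith [hr.1]))
            (expNegInvGlue.pos_of_pos (by linarith [hr.2]))) (mul_self_pos.2 hr0)⟩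
      simpa using h3
    exact hpos.ne' h1
  obtain ⟨c, hc⟩ := (LinearMap.injective_iff_surjective.1 hA) v
  exact ⟨fun r => w r * inner ℝ c (u r), hws.mul (contDiff_const.inner ℝ hu),
    fun r hr => by simp [hw0 r hr], hc⟩

theorem rinner_smul_I_mul (k : ℝ) (z : ℂ) : rinner (k • z) (Complex.I * z) = 0 := by
  simp [rinner]
  ring

theorem eq_smul_of_rinner_I_mul_eq_zero {z w : ℂ} (h : rinner z (Complex.I * w) = 0) :
    ‖w‖ ^ 2 • z = (inner ℝ z w : ℝ) • w := by
  rw [← Complex.normSq_eq_norm_sq]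
  simp [rinner] at h
  apply Complex.ext <;> simp [Complex.normSq_apply, Complex.inner]
  · linear_combination -w.im * h
  · linear_combination w.re * h

theorem rinner_lower_bound (z z' w w' : ℂ) :
    rinner z w - ‖z' - z‖ * ‖w'‖ - ‖z‖ * ‖w' - w‖ ≤ rinner z' w' := by
  have key : ∀ a b : ℂ, -(‖a‖ * ‖b‖) ≤ rinner a b := fun a b => by
    have := (abs_le.1 (Complex.abs_re_le_norm (a * (starRingEnd ℂ) b))).1
    rwa [norm_mul, Complex.norm_conj] at this
  have h1 := key (z' - z) w'
  have h2 := key z (w' - w)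
  have h3 : rinner z' w' = rinner z w + rinner (z' - z) w' + rinner z (w' - w) := by
    simp only [rinner, map_sub, sub_mul, mul_sub, Complex.sub_re]
    ring
  linarith

/-- A globally smooth factor `lam` with `g' = lam h'` on `[0,1]`. -/
theorem exists_smooth_multiplier {u v : ℝ → ℂ} (hu : ContDiff ℝ ∞ u) (hv : ContDiff ℝ ∞ v)
    (hu0 : ∀ r ∈ Set.Icc (0:ℝ) 1, u r ≠ 0)
    (h : ∀ r ∈ Set.Icc (0:ℝ) 1, rinner (v r) (Complex.I * u r) = 0) :
    ∃ lam : ℝ → ℝ, ContDiff ℝ ∞ lam ∧ ∀ r ∈ Set.Icc (0:ℝ) 1, v r = lam r • u r := by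
  have hden : ∀ r, ‖u r‖ ^ 2 + (expNegInvGlue (-r) + expNegInvGlue (r - 1)) ≠ 0 := by
    intro r
    have h1 := expNegInvGlue.nonneg (-r)
    have h2 := expNegInvGlue.nonneg (r - 1)
    have h3 := sq_nonneg ‖u r‖
    by_cases hr : r ∈ Set.Icc (0:ℝ) 1
    · have := pow_pos (norm_pos_iff.2 (hu0 r hr)) 2
      linarith
    · rcases lt_or_ge r 0 with h' | h'
      · have := expNegInvGlue.pos_of_pos (neg_pos.2 h')
        linarith
      · have : 1 < r := by
          by_contra! h''
          exact hr ⟨h', h''⟩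
        have := expNegInvGlue.pos_of_pos (sub_pos.2 this)
        linarith
  refine ⟨fun r => inner ℝ (v r) (u r) /
    (‖u r‖ ^ 2 + (expNegInvGlue (-r) + expNegInvGlue (r - 1))), ?_, ?_⟩
  · have h1 := expNegInvGlue.contDiff (n := ⊤)
    refine (hv.inner ℝ hu).div ((hu.norm_sq ℝ).add ?_) hden
    fun_prop
  · intro r hr
    have h0 : ‖u r‖ ^ 2 ≠ 0 := pow_ne_zero 2 (norm_ne_zero_iff.2 (hu0 r hr))
    simp only [expNegInvGlue.zero_of_nonpos (neg_nonpos.2 hr.1),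
      expNegInvGlue.zero_of_nonpos (sub_nonpos.2 hr.2), add_zero]
    rw [div_eq_inv_mul, mul_smul, ← eq_smul_of_rinner_I_mul_eq_zero (h r hr), smul_smul,
      inv_mul_cancel₀ h0, one_smul]

theorem deriv_eq_zero_of_eqOn_Icc {f : ℝ → ℂ} (hf : Differentiable ℝ f) {a b : ℝ} (hab : a < b)
    (h : Set.EqOn f 0 (Set.Icc a b)) {r : ℝ} (hr : r ∈ Set.Icc a b) : deriv f r = 0 := by
  have h1 : HasDerivWithinAt f (deriv f r) (Set.Icc a b) r := (hf r).hasDerivAt.hasDerivWithinAt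
  have h2 : HasDerivWithinAt f 0 (Set.Icc a b) r :=
    (hasDerivWithinAt_const r _ (0:ℂ)).congr h (h hr)
  exact (uniqueDiffOn_Icc hab r hr).eq_deriv _ h1 h2

theorem eq_left_of_deriv_eq_zero {f f' : ℝ → ℂ} {a b : ℝ} (hf : ∀ r, HasDerivAt f (f' r) r)
    (h : ∀ r ∈ Set.Icc a b, f' r = 0) {r : ℝ} (hr : r ∈ Set.Icc a b) : f r = f a :=
  constant_of_has_deriv_right_zero (fun x _ => (hf x).continuousAt.continuousWithinAt)
    (fun x hx => by
      have := (hf x).hasDerivWithinAt (s := Set.Ici x)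
      rwa [h x ⟨hx.1, hx.2.le⟩] at this) r hr

theorem norm_add_smul_le {M N t : ℝ} (hM : 1 ≤ M) (hN1 : N ≤ 1)
    (ht : t ∈ Set.Icc (0:ℝ) 1) {f k : ℂ} (hf : ‖f‖ ≤ M * M) (hk : ‖k‖ ≤ M * N) :
    ‖f + t • k‖ ≤ 2 * (M * M) := by
  have h1 : ‖t • k‖ ≤ ‖k‖ := by
    rw [norm_smul, Real.norm_of_nonneg ht.1]
    nlinarith [norm_nonneg k, ht.2]
  have h2 : M * N ≤ M * M := by gcongr; linarith
  linarith [norm_add_le f (t • k)]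

theorem norm_perturbation_le {M N t a b : ℝ} (hM : 1 ≤ M) (hN : 0 ≤ N) (hN1 : N ≤ 1)
    (ht : t ∈ Set.Icc (0:ℝ) 1) (ha : |a| ≤ 2 * (M * N)) (hb : |b| ≤ 2 * (M * N))
    {l f₁ k₁ f₂ k₂ : ℂ} (hl : ‖l‖ ≤ M * N) (hf₁ : ‖f₁‖ ≤ M * M) (hk₁ : ‖k₁‖ ≤ M * N)
    (hf₂ : ‖f₂‖ ≤ M * M) (hk₂ : ‖k₂‖ ≤ M * N) :
    ‖t • l + (a • (f₁ + t • k₁) + b • (f₂ + t • k₂))‖ ≤ 9 * (M ^ 3 * N) := by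
  have h1 := norm_add_smul_le hM hN1 ht hf₁ hk₁
  have h2 := norm_add_smul_le hM hN1 ht hf₂ hk₂
  have hMN : M * N ≤ M ^ 3 * N := by gcongr; exact le_self_pow₀ hM (by norm_num)
  have hMN0 : 0 ≤ M * N := by positivity
  calc _ ≤ ‖t • l‖ + (‖a • (f₁ + t • k₁)‖ + ‖b • (f₂ + t • k₂)‖) :=
        (norm_add_le _ _).trans (by gcongr; exact norm_add_le _ _)
    _ ≤ 1 * (M * N) + (2 * (M * N) * (2 * (M * M)) + 2 * (M * N) * (2 * (M * M))) := by
        simp only [norm_smul, Real.norm_eq_abs]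
        gcongr
        rw [abs_of_nonneg ht.1]
        exact ht.2
    _ ≤ _ := by nlinarith

theorem norm_perturbation_deriv_le {M N t a b a' b' : ℝ} (hM : 1 ≤ M) (hN : 0 ≤ N) (hN1 : N ≤ 1)
    (ht : t ∈ Set.Icc (0:ℝ) 1) (ha : |a| ≤ 2 * (M * N)) (hb : |b| ≤ 2 * (M * N))
    (ha' : |a'| ≤ 4 * (M * N)) (hb' : |b'| ≤ 4 * (M * N))
    {l f₁ k₁ f₂ k₂ : ℂ} (hl : ‖l‖ ≤ M * N) (hf₁ : ‖f₁‖ ≤ M * M) (hk₁ : ‖k₁‖ ≤ M * N)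
    (hf₂ : ‖f₂‖ ≤ M * M) (hk₂ : ‖k₂‖ ≤ M * N) :
    ‖l + ((a • k₁ + a' • (f₁ + t • k₁)) + (b • k₂ + b' • (f₂ + t • k₂)))‖
      ≤ 21 * (M ^ 3 * N) := by
  have h1 := norm_add_smul_le hM hN1 ht hf₁ hk₁
  have h2 := norm_add_smul_le hM hN1 ht hf₂ hk₂
  have hMN : M * N ≤ M ^ 3 * N := by gcongr; exact le_self_pow₀ hM (by norm_num)
  have hMN0 : 0 ≤ M * N := by positivity
  have hMN2 : M * N * (M * N) ≤ M ^ 3 * N := by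
    have : M * N * (M * N) = M * N * M * N := by ring
    nlinarith [mul_le_mul_of_nonneg_left hN1 (by positivity : 0 ≤ M * N * M),
      mul_le_mul_of_nonneg_left hM (by positivity : 0 ≤ M * N * M)]
  calc _ ≤ ‖l‖ + ((‖a • k₁‖ + ‖a' • (f₁ + t • k₁)‖) + (‖b • k₂‖ + ‖b' • (f₂ + t • k₂)‖)) := by
        refine (norm_add_le _ _).trans ?_
        gcongr
        refine (norm_add_le _ _).trans ?_
        gcongr <;> exact norm_add_le _ _
    _ ≤ M * N + ((2 * (M * N) * (M * N) + 4 * (M * N) * (2 * (M * M))) +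
          (2 * (M * N) * (M * N) + 4 * (M * N) * (2 * (M * M)))) := by
        simp only [norm_smul, Real.norm_eq_abs]
        gcongr
    _ ≤ _ := by nlinarith

/-- for the family `h̄ + t·ξ` with `ξ` vanishing on
`P = [0,ε] ∪ [1−ε,1]` and `C¹`-small, there is a smooth family of stabilizing
maps `g_t`, fixed on `P`, with `‖∂_t g_t‖_{C¹} ≤ C·‖ξ‖_{C¹}`. -/
theorem stmt7 (ε : ℝ) (hε0 : 0 < ε) (hε : ε < 1/2)
    (hbar gbar : ℝ → ℂ)
    (hbar_sm : ContDiff ℝ (⊤ : ℕ∞) hbar) (gbar_sm : ContDiff ℝ (⊤ : ℕ∞) gbar)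
    (hstab : StabOn hbar gbar (Set.Icc 0 1))
    (hnc : ∃ r₁ ∈ Set.Icc ε (1 - ε), ∃ r₂ ∈ Set.Icc ε (1 - ε),
      deriv hbar r₁ / (‖deriv hbar r₁‖ : ℂ) ≠ deriv hbar r₂ / (‖deriv hbar r₂‖ : ℂ)) :
    ∃ C : ℝ, 0 < C ∧ ∃ δ : ℝ, 0 < δ ∧
      ∀ ξ : ℝ → ℂ, ContDiff ℝ (⊤ : ℕ∞) ξ →
        Set.EqOn ξ 0 (Set.Icc 0 ε ∪ Set.Icc (1 - ε) 1) →
        C1Norm ξ < δ →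
        ∃ g : ℝ → ℝ → ℂ, ContDiff ℝ (⊤ : ℕ∞) (Function.uncurry g) ∧
          ∀ t ∈ Set.Icc (0:ℝ) 1,
            StabOn (fun r => hbar r + (t : ℂ) * ξ r) (g t) (Set.Icc 0 1) ∧
            Set.EqOn (g t) gbar (Set.Icc 0 ε ∪ Set.Icc (1 - ε) 1) ∧
            C1Norm (fun r => deriv (fun s => g s r) t) ≤ C * C1Norm ξ := by
  have hu : ContDiff ℝ ∞ (deriv hbar) := (contDiff_infty_iff_deriv.1 hbar_sm).2
  have hv : ContDiff ℝ ∞ (deriv gbar) := (contDiff_infty_iff_deriv.1 gbar_sm).2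
  set u := deriv hbar with hu_def
  have hu0 : ∀ r ∈ Set.Icc (0:ℝ) 1, u r ≠ 0 := by
    intro r hr h0
    have := (hstab r hr).2
    rw [← hu_def, h0] at this
    simp [rinner] at this
  obtain ⟨lam, hlam, hlam_eq⟩ := exists_smooth_multiplier hu hv hu0 fun r hr => (hstab r hr).1
  obtain ⟨φ₁, hφ₁, hφ₁0, hφ₁i⟩ := exists_weight hε0 hε hu hu0 hnc 1
  obtain ⟨φ₂, hφ₂, hφ₂0, hφ₂i⟩ := exists_weight hε0 hε hu hu0 hnc Complex.I
  obtain ⟨M, hM1, hMu, hMg, hMl, hMφ₁, hMφ₂⟩ : ∃ M : ℝ, 1 ≤ M ∧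
      (∀ r ∈ Set.Icc (0:ℝ) 1, ‖u r‖ ≤ M) ∧ (∀ r ∈ Set.Icc (0:ℝ) 1, ‖gbar r‖ ≤ M) ∧
      (∀ r ∈ Set.Icc (0:ℝ) 1, ‖lam r‖ ≤ M) ∧ (∀ r ∈ Set.Icc (0:ℝ) 1, ‖φ₁ r‖ ≤ M) ∧
      ∀ r ∈ Set.Icc (0:ℝ) 1, ‖φ₂ r‖ ≤ M := by
    have c1 := hu.continuous
    have c2 := gbar_sm.continuous
    have c3 := hlam.continuous
    have c4 := hφ₁.continuous
    have c5 := hφ₂.continuous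
    obtain ⟨M, hM⟩ := (isCompact_Icc (a := (0:ℝ)) (b := 1)).exists_bound_of_continuousOn
      (f := fun r => 1 + ‖u r‖ + ‖gbar r‖ + ‖lam r‖ + ‖φ₁ r‖ + ‖φ₂ r‖) (by fun_prop)
    have hM' : ∀ r ∈ Set.Icc (0:ℝ) 1, 1 + ‖u r‖ + ‖gbar r‖ + ‖lam r‖ + ‖φ₁ r‖ + ‖φ₂ r‖ ≤ M :=
      fun r hr => (Real.le_norm_self _).trans (hM r hr)
    refine ⟨M, ?_, ?_, ?_, ?_, ?_, ?_⟩
    · have := hM' 0 (by simp)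
      linarith [norm_nonneg (u 0), norm_nonneg (gbar 0), norm_nonneg (lam 0),
        norm_nonneg (φ₁ 0), norm_nonneg (φ₂ 0)]
    all_goals
      intro r hr
      have := hM' r hr
      linarith [norm_nonneg (u r), norm_nonneg (gbar r), norm_nonneg (lam r),
        norm_nonneg (φ₁ r), norm_nonneg (φ₂ r)]
  have hM0 : 0 < M := by linarith
  obtain ⟨m, hm0, hm⟩ : ∃ m : ℝ, 0 < m ∧
      ∀ r ∈ Set.Icc (0:ℝ) 1, m ≤ rinner (gbar r) (Complex.I * u r) := by
    have c1 := hu.continuous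
    have c2 := gbar_sm.continuous
    obtain ⟨r₀, hr₀, hmin⟩ := (isCompact_Icc (a := (0:ℝ)) (b := 1)).exists_isMinOn
      ⟨0, by simp⟩ (f := fun r => rinner (gbar r) (Complex.I * u r)) (by
        unfold rinner
        exact Continuous.continuousOn (by fun_prop))
    exact ⟨_, (hstab r₀ hr₀).2, fun r hr => hmin hr⟩
  refine ⟨42 * M ^ 3, by positivity, min (1 / (12 * M)) (m / (19 * M ^ 4)), by positivity, ?_⟩
  intro ξ hξ hξ0 hξN
  have hη : ContDiff ℝ ∞ (deriv ξ) := (contDiff_infty_iff_deriv.1 hξ).2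
  set η := deriv ξ with hη_def
  set N := C1Norm ξ with hN_def
  have hηN : ∀ r ∈ Set.Icc (0:ℝ) 1, ‖η r‖ ≤ N := fun r hr => norm_deriv_le_C1Norm hξ hr
  have hN0 : 0 ≤ N := (norm_nonneg _).trans (hηN 0 (by simp))
  have hN12 : 12 * (M * N) ≤ 1 := by
    have := (lt_min_iff.1 hξN).1
    rw [lt_div_iff₀ (by positivity)] at this
    linarith
  have hNm : 19 * (M ^ 4 * N) < m := by
    have := (lt_min_iff.1 hξN).2
    rw [lt_div_iff₀ (by positivity)] at this
    linarith
  have hN1 : N ≤ 1 := by nlinarith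
  have hP : ∀ r ∈ Set.Icc (0:ℝ) ε ∪ Set.Icc (1 - ε) 1, φ₁ r = 0 ∧ φ₂ r = 0 ∧ η r = 0 := by
    rintro r (hr | hr)
    · exact ⟨hφ₁0 r (Or.inl hr.2), hφ₂0 r (Or.inl hr.2),
        deriv_eq_zero_of_eqOn_Icc (hξ.differentiable (by simp)) hε0
          (hξ0.mono Set.subset_union_left) hr⟩
    · exact ⟨hφ₁0 r (Or.inr hr.1), hφ₂0 r (Or.inr hr.1),
        deriv_eq_zero_of_eqOn_Icc (hξ.differentiable (by simp)) (by linarith)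
          (hξ0.mono Set.subset_union_right) hr⟩
  have hnorm : ∀ {φ : ℝ → ℝ} {z : ℝ → ℂ} {K : ℝ}, (∀ r ∈ Set.Icc (0:ℝ) 1, ‖φ r‖ ≤ M) →
      (∀ r ∈ Set.Icc (0:ℝ) 1, ‖z r‖ ≤ K) → ∀ r ∈ Set.Icc (0:ℝ) 1, ‖φ r • z r‖ ≤ M * K := by
    intro φ z K h1 h2 r hr
    rw [norm_smul]
    have h3 := h1 r hr
    have h4 := h2 r hr
    gcongr
  have hMM : 0 ≤ M * M := by positivity
  have hMN : 0 ≤ M * N := by positivity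
  set L : ℝ → ℂ := fun r => ∫ s in (0:ℝ)..r, lam s • η s with hL
  set F₁ : ℝ → ℂ := fun r => ∫ s in (0:ℝ)..r, φ₁ s • u s with hF₁
  set F₂ : ℝ → ℂ := fun r => ∫ s in (0:ℝ)..r, φ₂ s • u s with hF₂
  set K₁ : ℝ → ℂ := fun r => ∫ s in (0:ℝ)..r, φ₁ s • η s with hK₁
  set K₂ : ℝ → ℂ := fun r => ∫ s in (0:ℝ)..r, φ₂ s • η s with hK₂
  have sL : ContDiff ℝ ∞ L := contDiff_primitive (hlam.smul hη)
  have sF₁ : ContDiff ℝ ∞ F₁ := contDiff_primitive (hφ₁.smul hu)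
  have sF₂ : ContDiff ℝ ∞ F₂ := contDiff_primitive (hφ₂.smul hu)
  have sK₁ : ContDiff ℝ ∞ K₁ := contDiff_primitive (hφ₁.smul hη)
  have sK₂ : ContDiff ℝ ∞ K₂ := contDiff_primitive (hφ₂.smul hη)
  have dL : ∀ r, HasDerivAt L (lam r • η r) r := hasDerivAt_primitive (hlam.smul hη).continuous
  have dF₁ : ∀ r, HasDerivAt F₁ (φ₁ r • u r) r := hasDerivAt_primitive (hφ₁.smul hu).continuous
  have dF₂ : ∀ r, HasDerivAt F₂ (φ₂ r • u r) r := hasDerivAt_primitive (hφ₂.smul hu).continuous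
  have dK₁ : ∀ r, HasDerivAt K₁ (φ₁ r • η r) r := hasDerivAt_primitive (hφ₁.smul hη).continuous
  have dK₂ : ∀ r, HasDerivAt K₂ (φ₂ r • η r) r := hasDerivAt_primitive (hφ₂.smul hη).continuous
  have bL : ∀ r ∈ Set.Icc (0:ℝ) 1, ‖L r‖ ≤ M * N :=
    fun r => norm_primitive_le hMN (hnorm hMl hηN)
  have bF₁ : ∀ r ∈ Set.Icc (0:ℝ) 1, ‖F₁ r‖ ≤ M * M :=
    fun r => norm_primitive_le hMM (hnorm hMφ₁ hMu)
  have bF₂ : ∀ r ∈ Set.Icc (0:ℝ) 1, ‖F₂ r‖ ≤ M * M :=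
    fun r => norm_primitive_le hMM (hnorm hMφ₂ hMu)
  have bK₁ : ∀ r ∈ Set.Icc (0:ℝ) 1, ‖K₁ r‖ ≤ M * N :=
    fun r => norm_primitive_le hMN (hnorm hMφ₁ hηN)
  have bK₂ : ∀ r ∈ Set.Icc (0:ℝ) 1, ‖K₂ r‖ ≤ M * N :=
    fun r => norm_primitive_le hMN (hnorm hMφ₂ hηN)
  have h01 : (1:ℝ) ∈ Set.Icc (0:ℝ) 1 := by simp
  obtain ⟨c, hc, hc_spec⟩ := exists_smooth_solution
    (Complex.reCLM.smulRight (K₁ 1) + Complex.imCLM.smulRight (K₂ 1)) (L 1) (by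
      refine ContinuousLinearMap.opNorm_le_bound _ (by norm_num) fun z => ?_
      change ‖z.re • K₁ 1 + z.im • K₂ 1‖ ≤ _
      have h1 := Complex.abs_re_le_norm z
      have h2 := Complex.abs_im_le_norm z
      calc _ ≤ ‖z.re • K₁ 1‖ + ‖z.im • K₂ 1‖ := norm_add_le _ _
        _ ≤ ‖z‖ * (M * N) + ‖z‖ * (M * N) := by
          simp only [norm_smul, Real.norm_eq_abs]
          have h3 := bK₁ 1 h01
          have h4 := bK₂ 1 h01
          gcongr
        _ ≤ _ := by nlinarith [norm_nonneg z])
  set a : ℝ → ℝ := fun t => (c t).re with ha_def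
  set b : ℝ → ℝ := fun t => (c t).im with hb_def
  have sa : ContDiff ℝ ∞ a := Complex.reCLM.contDiff.comp hc
  have sb : ContDiff ℝ ∞ b := Complex.imCLM.contDiff.comp hc
  have da : ∀ t, HasDerivAt a (deriv c t).re t := fun t =>
    Complex.reCLM.hasFDerivAt.comp_hasDerivAt t (hc.differentiable (by simp) t).hasDerivAt
  have db : ∀ t, HasDerivAt b (deriv c t).im t := fun t =>
    Complex.imCLM.hasFDerivAt.comp_hasDerivAt t (hc.differentiable (by simp) t).hasDerivAt
  set D : ℝ → ℝ → ℂ := fun t r =>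
    t • L r + (a t • (F₁ r + t • K₁ r) + b t • (F₂ r + t • K₂ r)) with hD
  have dD : ∀ t r, HasDerivAt (D t) (t • (lam r • η r) +
      (a t • (φ₁ r • u r + t • (φ₁ r • η r)) + b t • (φ₂ r • u r + t • (φ₂ r • η r)))) r :=
    fun t r => ((dL r).const_smul t).add
      ((((dF₁ r).add ((dK₁ r).const_smul t)).const_smul (a t)).add
        (((dF₂ r).add ((dK₂ r).const_smul t)).const_smul (b t)))
  refine ⟨fun t r => gbar r + D t r, ?_, fun t ht => ?_⟩
  · change ContDiff ℝ ∞ (fun p : ℝ × ℝ => gbar p.2 + (p.1 • L p.2 +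
      (a p.1 • (F₁ p.2 + p.1 • K₁ p.2) + b p.1 • (F₂ p.2 + p.1 • K₂ p.2))))
    fun_prop
  obtain ⟨hc_eq, hc_le, hc'_le⟩ := hc_spec t ht
  have hb1 := bL 1 h01
  have ba : |a t| ≤ 2 * (M * N) := (Complex.abs_re_le_norm _).trans (by linarith)
  have bb : |b t| ≤ 2 * (M * N) := (Complex.abs_im_le_norm _).trans (by linarith)
  have ba' : |(deriv c t).re| ≤ 4 * (M * N) := (Complex.abs_re_le_norm _).trans (by linarith)
  have bb' : |(deriv c t).im| ≤ 4 * (M * N) := (Complex.abs_im_le_norm _).trans (by linarith)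
  have hdh : ∀ r, deriv (fun r => hbar r + (t : ℂ) * ξ r) r = u r + t • η r := by
    intro r
    have h1 := (hbar_sm.differentiable (by simp) r).hasDerivAt
    have h2 := (hξ.differentiable (by simp) r).hasDerivAt
    rw [(h1.fun_add (h2.const_mul (t : ℂ))).deriv, Complex.real_smul]
  refine ⟨fun r hr => ⟨?_, ?_⟩, ?_, ?_⟩
  · have h1 := (gbar_sm.differentiable (by simp) r).hasDerivAt
    change rinner (deriv (fun r => gbar r + D t r) r) _ = 0
    rw [hdh, (h1.fun_add (dD t r)).deriv, hlam_eq r hr]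
    have h2 : lam r • u r + (t • lam r • η r + (a t • (φ₁ r • u r + t • φ₁ r • η r) +
        b t • (φ₂ r • u r + t • φ₂ r • η r))) =
        (lam r + a t * φ₁ r + b t * φ₂ r) • (u r + t • η r) := by
      module
    rw [h2]
    exact rinner_smul_I_mul _ _
  · rw [hdh]
    have h1 := rinner_lower_bound (gbar r) (gbar r + D t r) (Complex.I * u r)
      (Complex.I * (u r + t • η r))
    have h2 := norm_perturbation_le hM1 hN0 hN1 ht ba bb (bL r hr) (bF₁ r hr) (bK₁ r hr)
      (bF₂ r hr) (bK₂ r hr)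
    have h3 : ‖t • η r‖ ≤ N := by
      rw [norm_smul, Real.norm_of_nonneg ht.1]
      nlinarith [norm_nonneg (η r), hηN r hr, ht.2]
    have h4 : ‖u r + t • η r‖ ≤ 2 * M := (norm_add_le _ _).trans (by linarith [hMu r hr])
    rw [add_sub_cancel_left, ← mul_sub, add_sub_cancel_left, norm_mul, norm_mul, Complex.norm_I,
      one_mul, one_mul] at h1
    have h5 : ‖D t r‖ * ‖u r + t • η r‖ ≤ 9 * (M ^ 3 * N) * (2 * M) := by gcongr
    have h6 : ‖gbar r‖ * ‖t • η r‖ ≤ M * N := by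
      have := hMg r hr
      gcongr
    have h7 : M * N ≤ M ^ 4 * N := by gcongr; exact le_self_pow₀ hM1 (by norm_num)
    have h8 := hm r hr
    have h9 : 9 * (M ^ 3 * N) * (2 * M) = 18 * (M ^ 4 * N) := by ring
    linarith
  · have hD0 : ∀ r ∈ Set.Icc (0:ℝ) ε ∪ Set.Icc (1 - ε) 1, t • (lam r • η r) +
        (a t • (φ₁ r • u r + t • (φ₁ r • η r)) + b t • (φ₂ r • u r + t • (φ₂ r • η r))) = 0 := by
      intro r hr
      obtain ⟨h1, h2, h3⟩ := hP r hr
      simp [h1, h2, h3]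
    have hDl : D t 0 = 0 := by simp [hD, hL, hF₁, hF₂, hK₁, hK₂]
    have hDr : D t 1 = 0 := by
      have h1 : F₁ 1 = 1 := hφ₁i
      have h2 : F₂ 1 = Complex.I := hφ₂i
      have h3 : c t + t • (L 1 + (a t • K₁ 1 + b t • K₂ 1)) = 0 := hc_eq
      have h4 : c t = a t • (1:ℂ) + b t • Complex.I := by
        apply Complex.ext <;> simp [ha_def, hb_def]
      rw [h4] at h3
      rw [← h3]
      simp only [hD, h1, h2]
      module
    rintro r (hr | hr)
    · have := eq_left_of_deriv_eq_zero (dD t) (fun r hr => hD0 r (Or.inl hr)) hr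
      simp only [this, hDl, add_zero]
    · have h1 := eq_left_of_deriv_eq_zero (dD t) (fun r hr => hD0 r (Or.inr hr)) hr
      have h2 := eq_left_of_deriv_eq_zero (dD t) (fun r hr => hD0 r (Or.inr hr))
        (Set.right_mem_Icc.2 (hr.1.trans hr.2))
      simp only [h1, ← h2, hDr, add_zero]
  · have h1 : (fun r => deriv (fun s => gbar r + D s r) t) = fun r =>
        L r + ((a t • K₁ r + (deriv c t).re • (F₁ r + t • K₁ r)) +
          (b t • K₂ r + (deriv c t).im • (F₂ r + t • K₂ r))) := by
      funext r
      have e : ∀ v : ℂ, HasDerivAt (fun s : ℝ => s • v) v t := fun v => by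
        simpa using (hasDerivAt_id t).smul_const v
      exact (((e (L r)).add (((da t).smul ((e (K₁ r)).const_add (F₁ r))).add
        ((db t).smul ((e (K₂ r)).const_add (F₂ r))))).const_add (gbar r)).deriv
    rw [h1]
    have h2 : 42 * M ^ 3 * N = 2 * (21 * (M ^ 3 * N)) := by ring
    rw [h2]
    refine C1Norm_le (fun r hr => ?_) (fun r hr => ?_)
    · exact norm_perturbation_deriv_le hM1 hN0 hN1 ht ba bb ba' bb' (bL r hr) (bF₁ r hr)
        (bK₁ r hr) (bF₂ r hr) (bK₂ r hr)
    · have h3 := (dL r).add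
        ((((dK₁ r).const_smul (a t)).add
            (((dF₁ r).add ((dK₁ r).const_smul t)).const_smul (deriv c t).re)).add
          (((dK₂ r).const_smul (b t)).add
            (((dF₂ r).add ((dK₂ r).const_smul t)).const_smul (deriv c t).im)))
      refine (congrArg norm h3.deriv).trans_le ?_
      exact norm_perturbation_deriv_le hM1 hN0 hN1 ht ba bb ba' bb' (hnorm hMl hηN r hr)
        (hnorm hMφ₁ hMu r hr) (hnorm hMφ₁ hηN r hr) (hnorm hMφ₂ hMu r hr) (hnorm hMφ₂ hηN r hr)
end
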